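/- Let n ≥ 1 and α ∈ (0,1). Let A be an (n+1) × (n+1) matrix with entries in {0,1} such that A_{ii} = 0 for every i and A_{ij} + A_{ji} = 1 for all i ≠ j (a tournament matrix). Define the strange set S(A) = { i ∈ {1,…,n+1} : Σ_{j=1}^{n+1} A_{ij} ≥ (1−α)(n+1) }. Then the cardinality of S(A) satisfies |S(A)| ≤ 2α(n+1). -/

import Mathlib

/-- Summing over all ordered pairs in `S`, entries with `A i j + A j i ≤ 1` total at most half
the number of pairs. -/
theorem two_mul_sum_sum_le_card_mul_card {ι : Type*} (A : Matrix ι ι ℝ) (S : Finset ι)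
    (hpair : ∀ i j, A i j + A j i ≤ 1) :
    2 * ∑ i ∈ S, ∑ j ∈ S, A i j ≤ (S.card : ℝ) * S.card := by
  calc 2 * ∑ i ∈ S, ∑ j ∈ S, A i j
      = ∑ i ∈ S, ∑ j ∈ S, (A i j + A j i) := by
        simp only [Finset.sum_add_distrib]
        rw [Finset.sum_comm (f := fun i j => A j i), two_mul]
    _ ≤ ∑ _i ∈ S, ∑ _j ∈ S, (1 : ℝ) :=
        Finset.sum_le_sum fun i _ => Finset.sum_le_sum fun j _ => hpair i j
    _ = (S.card : ℝ) * S.card := by simp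

/-- If every row indexed by the nonempty set `S` has sum at least `c`, and `A i j ≤ 1` and
`A i j + A j i ≤ 1` throughout, then `S` has at most `2 (|ι| - c)` elements. -/
theorem card_le_of_le_row_sum {ι : Type*} [Fintype ι] (A : Matrix ι ι ℝ) (S : Finset ι) (c : ℝ)
    (hle : ∀ i j, A i j ≤ 1) (hpair : ∀ i j, A i j + A j i ≤ 1)
    (hrow : ∀ i ∈ S, c ≤ ∑ j, A i j) (hS : S.Nonempty) :
    (S.card : ℝ) ≤ 2 * (Fintype.card ι - c) := by
  classical
  have hlower : S.card * c ≤ ∑ i ∈ S, ∑ j, A i j := by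
    simpa using Finset.card_nsmul_le_sum S _ c hrow
  have hsplit : ∑ i ∈ S, ∑ j, A i j = ∑ i ∈ S, ∑ j ∈ S, A i j + ∑ i ∈ S, ∑ j ∈ Sᶜ, A i j := by
    simp only [← Finset.sum_add_distrib, Finset.sum_add_sum_compl]
  have hout : ∑ i ∈ S, ∑ j ∈ Sᶜ, A i j ≤ S.card * (Fintype.card ι - S.card) := by
    calc ∑ i ∈ S, ∑ j ∈ Sᶜ, A i j ≤ ∑ _i ∈ S, ∑ _j ∈ Sᶜ, (1 : ℝ) :=
          Finset.sum_le_sum fun i _ => Finset.sum_le_sum fun j _ => hle i j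
      _ = S.card * (Fintype.card ι - S.card) := by
          simp [Finset.card_compl, Nat.cast_sub S.card_le_univ]
          ring
  have hin := two_mul_sum_sum_le_card_mul_card A S hpair
  have hpos : (0 : ℝ) < S.card := by exact_mod_cast hS.card_pos
  refine le_of_mul_le_mul_left ?_ hpos
  linarith

/-- **Strange-set bound for the Jackknife+/J+GP proof.** If `A` is an `(n+1) × (n+1)`
tournament matrix (entries in `{0,1}`, zero diagonal, `A i j + A j i = 1` for `i ≠ j`),
then the set of "strange" points, i.e. the indices `i` whose row sum is at least
`(1-α)(n+1)`, has cardinality at most `2α(n+1)`. -/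
theorem strange_set_card_le_jackknifePlus
    (n : ℕ) (hn : 1 ≤ n) (α : ℝ) (hα : α ∈ Set.Ioo (0 : ℝ) 1)
    (A : Matrix (Fin (n + 1)) (Fin (n + 1)) ℝ)
    (hA01 : ∀ i j, A i j = 0 ∨ A i j = 1)
    (hAdiag : ∀ i, A i i = 0)
    (hAtour : ∀ i j, i ≠ j → A i j + A j i = 1) :
    (({i : Fin (n + 1) | (1 - α) * (n + 1) ≤ ∑ j, A i j}.ncard : ℝ)) ≤
      2 * α * (n + 1) := by
  classical
  rw [Set.ncard_eq_toFinset_card']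
  set S := {i : Fin (n + 1) | (1 - α) * (n + 1) ≤ ∑ j, A i j}.toFinset with hSdef
  rcases S.eq_empty_or_nonempty with hS | hS
  · have := hα.1
    rw [hS, Finset.card_empty, Nat.cast_zero]
    positivity
  · have hle : ∀ i j, A i j ≤ 1 := fun i j => by
      rcases hA01 i j with h | h <;> simp [h]
    have hpair : ∀ i j, A i j + A j i ≤ 1 := fun i j => by
      rcases eq_or_ne i j with rfl | hij
      · simp [hAdiag]
      · exact (hAtour i j hij).le
    have hcard := card_le_of_le_row_sum A S ((1 - α) * (n + 1)) hle hpair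
      (fun i hi => by simpa [hSdef] using hi) hS
    rw [Fintype.card_fin] at hcard
    push_cast at hcard
    linarith
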